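/- For every real number w ≥ 1 there exists a natural number n with n ≤ 4·ln(3w) (natural logarithm) such that the Reminis ramp-up congestion window at step n, namely (1/3)·(10^(1−n)·13^n − 13), is at least w. (Hence the combined AIMD-plus-exploration logic reaches any target window w₁ in O(log w₁) sampling intervals, instead of the O(w₁) intervals an additive-increase rule alone would need.) -/

import Mathlib

/-- For every real number `w ≥ 1` there exists a natural number `n` with
`n ≤ 4 * ln (3 * w)` such that the Reminis ramp-up congestion window at step `n`,
namely `(1/3) * (10 ^ (1 - n) * 13 ^ n - 13)`, is at least `w`. -/
theorem reminis_rampup_log_steps (w : ℝ) (hw : 1 ≤ w) :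
    ∃ n : ℕ, (n : ℝ) ≤ 4 * Real.log (3 * w) ∧
      w ≤ (1 / 3) * ((10 : ℝ) ^ (1 - (n : ℤ)) * (13 : ℝ) ^ (n : ℕ) - 13) := by
  have hl : (1 : ℝ) / 4 ≤ Real.log (13 / 10) := by
    have h1 : (1 : ℝ) ≤ Real.log ((13 / 10) ^ 4) := by
      rw [Real.le_log_iff_exp_le (by norm_num)]
      have := Real.exp_one_lt_d9
      norm_num at this ⊢
      linarith
    rw [Real.log_pow] at h1
    push_cast at h1
    linarith
  have hx : (0 : ℝ) < 3 * w := by linarith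
  have hlog : 0 ≤ Real.log (3 * w) := Real.log_nonneg (by linarith)
  refine ⟨⌊4 * Real.log (3 * w)⌋₊, Nat.floor_le (by linarith), ?_⟩
  have hn := Nat.lt_floor_add_one (4 * Real.log (3 * w))
  generalize ⌊4 * Real.log (3 * w)⌋₊ = n at hn ⊢
  have hp : 3 * w ≤ (13 / 10 : ℝ) ^ (n + 1) := by
    rw [← Real.log_le_log_iff hx (by positivity), Real.log_pow]
    push_cast
    have h0 : (0 : ℝ) ≤ (n : ℝ) + 1 := by positivity
    have := mul_le_mul_of_nonneg_left hl h0
    linarith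
  have he : (10 : ℝ) ^ (1 - (n : ℤ)) * (13 : ℝ) ^ (n : ℕ) = 10 * (13 / 10 : ℝ) ^ n := by
    rw [zpow_sub₀ (by norm_num), zpow_one, zpow_natCast, div_pow]
    ring
  rw [he]
  rw [pow_succ] at hp
  linarith
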